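/- arXiv:2503.00539 — 3 statements merged into one kernel-verified Lean document; each statement's English description precedes it below -/
import Mathlib

section
/- Let X and Y be finite sets, let D₀ and D_src be probability distributions on X with D_src(x) > 0 for every x, and for each x ∈ X let p(·|x) and q(·|x) be probability distributions on Y with q(y|x) > 0 whenever p(y|x) > 0. Then Σ_{x∈X} D₀(x) · d_TV( p(·|x), q(·|x) ) ≤ sqrt( (1 + d_{χ²}(D₀, D_src)) / 2 ) · sqrt( Σ_{x∈X} D_src(x) · D_KL( p(·|x) ‖ q(·|x) ) ), where d_TV is the total variation distance, d_{χ²}(D₀,D_src) = Σ_x (D₀(x)−D_src(x))²/D_src(x), and D_KL is the Kullback–Leibler divergence. -/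
open scoped BigOperators

lemma aux_hasDeriv (t : ℝ) (ht : 0 < t) :
    HasDerivAt (fun t : ℝ => Real.log t - (5*t^2-4*t-1)/(2*t^2+4*t))
      (4*(t-1)^3/(2*t^2+4*t)^2) t := by
  have hne : 2*t^2+4*t ≠ 0 := by positivity
  have h1 : HasDerivAt (fun t : ℝ => 5*t^2-4*t-1) (10*t-4) t := by
    have := (((hasDerivAt_pow 2 t).const_mul 5).sub ((hasDerivAt_id t).const_mul 4)).sub_const 1
    refine HasDerivAt.congr_deriv this ?_
    norm_num; try ring
  have h2 : HasDerivAt (fun t : ℝ => 2*t^2+4*t) (4*t+4) t := by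
    have := ((hasDerivAt_pow 2 t).const_mul 2).add ((hasDerivAt_id t).const_mul 4)
    refine HasDerivAt.congr_deriv this ?_
    norm_num; try ring
  have := (Real.hasDerivAt_log ht.ne').sub (h1.div h2 hne)
  refine HasDerivAt.congr_deriv this ?_
  field_simp
  ring

lemma aux_log_ge (t : ℝ) (ht : 0 < t) :
    (5*t^2-4*t-1)/(2*t^2+4*t) ≤ Real.log t := by
  set f : ℝ → ℝ := fun t => Real.log t - (5*t^2-4*t-1)/(2*t^2+4*t) with hf
  have f1 : f 1 = 0 := by simp [hf]; norm_num
  suffices h : f 1 ≤ f t by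
    rw [f1] at h; simp only [hf] at h; linarith
  rcases le_total 1 t with h | h
  · have hm : MonotoneOn f (Set.Ici 1) := by
      apply monotoneOn_of_deriv_nonneg (convex_Ici 1)
      · intro x hx
        exact (aux_hasDeriv x (lt_of_lt_of_le one_pos hx)).continuousAt.continuousWithinAt
      · intro x hx
        rw [interior_Ici] at hx
        exact (aux_hasDeriv x (one_pos.trans hx)).differentiableAt.differentiableWithinAt
      · intro x hx
        rw [interior_Ici] at hx
        rw [(aux_hasDeriv x (one_pos.trans hx)).deriv]
        have : 0 ≤ x - 1 := sub_nonneg.2 (le_of_lt hx)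
        positivity
    exact hm (Set.mem_Ici.2 le_rfl) h h
  · have hm : AntitoneOn f (Set.Ioc 0 1) := by
      apply antitoneOn_of_deriv_nonpos (convex_Ioc 0 1)
      · intro x hx
        exact (aux_hasDeriv x hx.1).continuousAt.continuousWithinAt
      · intro x hx
        rw [interior_Ioc] at hx
        exact (aux_hasDeriv x hx.1).differentiableAt.differentiableWithinAt
      · intro x hx
        rw [interior_Ioc] at hx
        rw [(aux_hasDeriv x hx.1).deriv]
        have h0 : 0 ≤ 1 - x := sub_nonneg.2 hx.2.le
        have h3 : 0 ≤ (1-x)^3 := by positivity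
        apply div_nonpos_of_nonpos_of_nonneg
        · nlinarith
        · positivity
    exact hm ⟨ht, h⟩ ⟨one_pos, le_rfl⟩ h

lemma aux_pointwise (a b : ℝ) (ha : 0 ≤ a) (hb : 0 ≤ b) (hab : 0 < a → 0 < b) :
    0 ≤ a * Real.log (a/b) - a + b ∧
    (a-b)^2 ≤ ((2*a+4*b)/3) * (a * Real.log (a/b) - a + b) := by
  rcases ha.eq_or_lt with rfl | ha
  · simp; exact ⟨hb, by nlinarith⟩
  · have hb := hab ha
    have h := aux_log_ge (a/b) (by positivity)
    have e : (5*(a/b)^2-4*(a/b)-1)/(2*(a/b)^2+4*(a/b)) = (5*a^2-4*a*b-b^2)/(2*a*(a+2*b)) := by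
      field_simp
      try ring
    rw [e] at h
    have h2 := mul_le_mul_of_nonneg_left h ha.le
    have e2 : a * ((5*a^2-4*a*b-b^2)/(2*a*(a+2*b))) = a - b + 3*(a-b)^2/(2*a+4*b) := by
      field_simp
      ring
    rw [e2] at h2
    have h3 : 3*(a-b)^2/(2*a+4*b) ≤ a * Real.log (a/b) - a + b := by linarith
    refine ⟨le_trans (by positivity) h3, ?_⟩
    rw [div_le_iff₀ (by positivity)] at h3
    linarith

lemma aux_pinsker {Y : Type*} [Fintype Y] (p q : Y → ℝ)
    (hp : ∀ y, 0 ≤ p y) (hpsum : ∑ y : Y, p y = 1)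
    (hq : ∀ y, 0 ≤ q y) (hqsum : ∑ y : Y, q y = 1)
    (hqpos : ∀ y, 0 < p y → 0 < q y) :
    ((1 / 2) * ∑ y : Y, |p y - q y|)^2 ≤ (∑ y : Y, p y * Real.log (p y / q y)) / 2 := by
  have hpt := fun y => aux_pointwise (p y) (q y) (hp y) (hq y) (hqpos y)
  have h := Finset.sum_sq_le_sum_mul_sum_of_sq_le_mul (Finset.univ : Finset Y)
    (r := fun y => |p y - q y|) (f := fun y => (2*p y+4*q y)/3)
    (g := fun y => p y * Real.log (p y / q y) - p y + q y)
    (fun y _ => by have := hp y; have := hq y; positivity) (fun y _ => (hpt y).1)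
    (fun y _ => by rw [sq_abs]; exact (hpt y).2)
  have e1 : ∑ y, (2*p y+4*q y)/3 = 2 := by
    rw [← Finset.sum_div, Finset.sum_add_distrib, ← Finset.mul_sum, ← Finset.mul_sum, hpsum, hqsum]
    norm_num
  rw [e1, Finset.sum_add_distrib, Finset.sum_sub_distrib, hpsum, hqsum] at h
  linarith


/-- a Cauchy–Schwarz/Pinsker bound:
`Σ_x D₀(x)·d_TV(p(·|x), q(·|x)) ≤ sqrt((1 + d_{χ²}(D₀,D_src))/2) · sqrt(Σ_x D_src(x)·D_KL(p(·|x)‖q(·|x)))`. -/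
theorem weighted_tv_le_sqrt_chiSq_mul_sqrt_kl {X Y : Type*} [Fintype X] [Fintype Y]
    (D0 Dsrc : X → ℝ)
    (hD0 : ∀ x, 0 ≤ D0 x) (hD0sum : ∑ x : X, D0 x = 1)
    (hDsrc : ∀ x, 0 < Dsrc x) (hDsrcsum : ∑ x : X, Dsrc x = 1)
    (p q : X → Y → ℝ)
    (hp : ∀ x y, 0 ≤ p x y) (hpsum : ∀ x, ∑ y : Y, p x y = 1)
    (hq : ∀ x y, 0 ≤ q x y) (hqsum : ∀ x, ∑ y : Y, q x y = 1)
    (hqpos : ∀ x y, 0 < p x y → 0 < q x y) :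
    ∑ x : X, D0 x * ((1 / 2) * ∑ y : Y, |p x y - q x y|) ≤
      Real.sqrt ((1 + ∑ x : X, (D0 x - Dsrc x) ^ 2 / Dsrc x) / 2) *
        Real.sqrt (∑ x : X, Dsrc x * ∑ y : Y, p x y * Real.log (p x y / q x y)) := by

  have hpin := fun x => aux_pinsker (p x) (q x) (hp x) (hpsum x) (hq x) (hqsum x) (hqpos x)
  set T : X → ℝ := fun x => (1 / 2) * ∑ y : Y, |p x y - q x y| with hT
  set K : X → ℝ := fun x => ∑ y : Y, p x y * Real.log (p x y / q x y) with hK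
  have hcs := Finset.sum_sq_le_sum_mul_sum_of_sq_le_mul (Finset.univ : Finset X)
    (r := fun x => D0 x * T x) (f := fun x => D0 x ^ 2 / Dsrc x)
    (g := fun x => Dsrc x * T x ^ 2)
    (fun x _ => by have := hDsrc x; positivity) (fun x _ => by have := hDsrc x; positivity)
    (fun x _ => by
      have := (hDsrc x).ne'
      apply le_of_eq
      field_simp)
  have hchi : 1 + ∑ x : X, (D0 x - Dsrc x) ^ 2 / Dsrc x = ∑ x, D0 x ^ 2 / Dsrc x := by
    have : ∀ x, (D0 x - Dsrc x) ^ 2 / Dsrc x = D0 x ^ 2 / Dsrc x - 2 * D0 x + Dsrc x := by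
      intro x
      have := (hDsrc x).ne'
      field_simp
      ring
    simp_rw [this]
    rw [Finset.sum_add_distrib, Finset.sum_sub_distrib, ← Finset.mul_sum, hD0sum, hDsrcsum]
    ring
  have hA : 0 ≤ ∑ x, D0 x ^ 2 / Dsrc x :=
    Finset.sum_nonneg fun x _ => by have := hDsrc x; positivity
  have hTK : ∑ x, Dsrc x * T x ^ 2 ≤ (∑ x, Dsrc x * K x) / 2 := by
    rw [Finset.sum_div]
    apply Finset.sum_le_sum
    intro x _
    rw [mul_div_assoc]
    exact mul_le_mul_of_nonneg_left (hpin x) (hDsrc x).le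
  rw [hchi, ← Real.sqrt_mul (by positivity)]
  apply Real.le_sqrt_of_sq_le
  have := mul_le_mul_of_nonneg_left hTK hA
  calc _ ≤ _ := hcs
    _ ≤ _ := this
    _ = _ := by ring
end

section
/- (Suboptimality gap from small potential.) Let X and Y be finite sets, D_src a distribution on X with D_src(x) ≥ ν > 0 for all x, ψ a feature map with ‖ψ(x,y)‖₂ ≤ 1, and Π the log-linear policy class { π_θ : ‖θ‖₂ ≤ B } over Y, with reference policy π_ref = π_{θ_ref}, ‖θ_ref‖₂ ≤ B, B ≥ 1. Let r be a reward with r(x,y) ∈ [0, r_max], β > 0, and define v(θ; D) = E_{x∼D, y∼π_θ(·|x)}[ r(x,y) − β log(π_θ(y|x)/π_ref(y|x)) ], the robust value v_TV(θ; D_src) = inf_{D : d_TV(D, D_src) ≤ ρ} v(θ; D) where the infimum is over probability distributions D on X, and let θ⋆ maximize v_TV(·; D_src) over {‖θ‖₂ ≤ B}. Define the potential Φ(π_θ) = Σ_x D_src(x) Σ_y π_{θ⋆}(y|x) log( π_{θ⋆}(y|x) / π_θ(y|x) ). If Φ(π_θ) ≤ ε, then v_TV(θ⋆; D_src) − v_TV(θ;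 D_src) ≤ 2√2 (r_max + 3βB²) sqrt( (1 + 4ρ²/ν) ε ). -/
open scoped RealInnerProductSpace BigOperators

/-- The log-linear (softmax) policy `π_θ(y|x) = exp(θᵀψ(x,y)) / Σ_{y'} exp(θᵀψ(x,y'))`. -/
noncomputable def softmaxPolicy {X Y : Type*} [Fintype Y] {d : ℕ}
    (ψ : X → Y → EuclideanSpace ℝ (Fin d)) (θ : EuclideanSpace ℝ (Fin d))
    (x : X) (y : Y) : ℝ :=
  Real.exp ⟪θ, ψ x y⟫ / ∑ y' : Y, Real.exp ⟪θ, ψ x y'⟫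

/-- The KL-regularized value `v(θ; D) = E_{x∼D, y∼π_θ(·|x)}[ r(x,y) − β log(π_θ(y|x)/π_ref(y|x)) ]`. -/
noncomputable def klValue {X Y : Type*} [Fintype X] [Fintype Y] {d : ℕ}
    (ψ : X → Y → EuclideanSpace ℝ (Fin d)) (r : X → Y → ℝ) (β : ℝ)
    (θref θ : EuclideanSpace ℝ (Fin d)) (D : X → ℝ) : ℝ :=
  ∑ x : X, D x * ∑ y : Y, softmaxPolicy ψ θ x y *
    (r x y - β * Real.log (softmaxPolicy ψ θ x y / softmaxPolicy ψ θref x y))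

/-- The TV-robust value `v_TV(θ; D_src) = inf_{D : d_TV(D, D_src) ≤ ρ} v(θ; D)`, the infimum
ranging over probability distributions `D` on the prompt set. -/
noncomputable def robustValue {X Y : Type*} [Fintype X] [Fintype Y] {d : ℕ}
    (ψ : X → Y → EuclideanSpace ℝ (Fin d)) (r : X → Y → ℝ) (β : ℝ)
    (θref : EuclideanSpace ℝ (Fin d)) (Dsrc : X → ℝ) (ρ : ℝ)
    (θ : EuclideanSpace ℝ (Fin d)) : ℝ :=
  sInf { c : ℝ | ∃ D : X → ℝ, (∀ x, 0 ≤ D x) ∧ (∑ x : X, D x = 1) ∧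
    ((1 / 2) * ∑ x : X, |D x - Dsrc x| ≤ ρ) ∧ c = klValue ψ r β θref θ D }

/-- The potential `Φ(π_θ) = Σ_x D_src(x) Σ_y π_{θ⋆}(y|x) log(π_{θ⋆}(y|x)/π_θ(y|x))`. -/
noncomputable def potential {X Y : Type*} [Fintype X] [Fintype Y] {d : ℕ}
    (ψ : X → Y → EuclideanSpace ℝ (Fin d)) (Dsrc : X → ℝ)
    (θstar θ : EuclideanSpace ℝ (Fin d)) : ℝ :=
  ∑ x : X, Dsrc x * ∑ y : Y, softmaxPolicy ψ θstar x y *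
    Real.log (softmaxPolicy ψ θstar x y / softmaxPolicy ψ θ x y)

lemma sm_pos {X Y : Type*} [Fintype Y] [Nonempty Y] {d : ℕ}
    (ψ : X → Y → EuclideanSpace ℝ (Fin d)) (θ : EuclideanSpace ℝ (Fin d)) (x : X) (y : Y) :
    0 < softmaxPolicy ψ θ x y := by
  unfold softmaxPolicy
  exact div_pos (Real.exp_pos _)
    (Finset.sum_pos (fun _ _ => Real.exp_pos _) Finset.univ_nonempty)

lemma sm_sum {X Y : Type*} [Fintype Y] [Nonempty Y] {d : ℕ}
    (ψ : X → Y → EuclideanSpace ℝ (Fin d)) (θ : EuclideanSpace ℝ (Fin d)) (x : X) :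
    ∑ y, softmaxPolicy ψ θ x y = 1 := by
  unfold softmaxPolicy
  rw [← Finset.sum_div]
  exact div_self (Finset.sum_pos (fun _ _ => Real.exp_pos _) Finset.univ_nonempty).ne'

lemma sm_log {X Y : Type*} [Fintype Y] [Nonempty Y] {d : ℕ}
    (ψ : X → Y → EuclideanSpace ℝ (Fin d)) (θ : EuclideanSpace ℝ (Fin d)) (x : X) (y : Y) :
    Real.log (softmaxPolicy ψ θ x y) =
      ⟪θ, ψ x y⟫ - Real.log (∑ y' : Y, Real.exp ⟪θ, ψ x y'⟫) := by
  unfold softmaxPolicy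
  rw [Real.log_div (Real.exp_pos _).ne'
    (Finset.sum_pos (fun _ _ => Real.exp_pos _) Finset.univ_nonempty).ne', Real.log_exp]

/-- A weak Pinsker inequality through the Hellinger distance. -/
lemma weak_pinsker {Y : Type*} [Fintype Y] (p q : Y → ℝ) (hp : ∀ y, 0 < p y)
    (hq : ∀ y, 0 < q y) (hps : ∑ y, p y = 1) (hqs : ∑ y, q y = 1) :
    0 ≤ ∑ y, p y * Real.log (p y / q y) ∧
    ∑ y, |p y - q y| ≤ 2 * Real.sqrt (∑ y, p y * Real.log (p y / q y)) := by
  have hsp : ∀ y, Real.sqrt (p y) ^ 2 = p y := fun y => Real.sq_sqrt (hp y).le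
  have hsq : ∀ y, Real.sqrt (q y) ^ 2 = q y := fun y => Real.sq_sqrt (hq y).le
  have h1 : ∑ y, (Real.sqrt (p y) - Real.sqrt (q y)) ^ 2 ≤ ∑ y, p y * Real.log (p y / q y) := by
    have h : ∑ y, (Real.sqrt (p y) - Real.sqrt (q y)) ^ 2
        = ∑ y, (2 * p y - 2 * (Real.sqrt (p y) * Real.sqrt (q y))) := by
      have : ∀ y, (Real.sqrt (p y) - Real.sqrt (q y)) ^ 2
          = (2 * p y - 2 * (Real.sqrt (p y) * Real.sqrt (q y))) + (q y - p y) := by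
        intro y
        have := hsp y
        have := hsq y
        nlinarith
      simp_rw [this]
      rw [Finset.sum_add_distrib, Finset.sum_sub_distrib q p, hps, hqs]
      ring
    rw [h]
    refine Finset.sum_le_sum fun y _ => ?_
    have ha := Real.sqrt_pos.2 (hp y)
    have hb := Real.sqrt_pos.2 (hq y)
    have hl := Real.log_le_sub_one_of_pos (div_pos hb ha)
    have hlog : Real.log (p y / q y) = - 2 * Real.log (Real.sqrt (q y) / Real.sqrt (p y)) := by
      rw [Real.log_div hb.ne' ha.ne', Real.log_div (hp y).ne' (hq y).ne',
        Real.log_sqrt (hp y).le, Real.log_sqrt (hq y).le]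
      ring
    rw [hlog]
    have hm := mul_le_mul_of_nonneg_left hl (hp y).le
    have he : p y * (Real.sqrt (q y) / Real.sqrt (p y) - 1)
        = Real.sqrt (p y) * Real.sqrt (q y) - p y := by
      rw [mul_sub, mul_one]
      congr 1
      rw [← mul_div_assoc, div_eq_iff ha.ne']
      linear_combination (-Real.sqrt (q y)) * hsp y
    linarith
  have h0 : 0 ≤ ∑ y, (Real.sqrt (p y) - Real.sqrt (q y)) ^ 2 :=
    Finset.sum_nonneg fun _ _ => sq_nonneg _
  refine ⟨h0.trans h1, ?_⟩
  have h2 : (∑ y, |p y - q y|) ^ 2 ≤ (∑ y, (Real.sqrt (p y) - Real.sqrt (q y)) ^ 2) *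
      ∑ y, (Real.sqrt (p y) + Real.sqrt (q y)) ^ 2 := by
    refine Finset.sum_sq_le_sum_mul_sum_of_sq_eq_mul _ (fun _ _ => sq_nonneg _)
      (fun _ _ => sq_nonneg _) fun y _ => ?_
    rw [sq_abs, ← mul_pow]
    congr 1
    linear_combination hsq y - hsp y
  have h3 : ∑ y, (Real.sqrt (p y) + Real.sqrt (q y)) ^ 2 ≤ 4 := by
    calc _ ≤ ∑ y, (2 * p y + 2 * q y) := Finset.sum_le_sum fun y _ => by
            nlinarith [hsp y, hsq y, sq_nonneg (Real.sqrt (p y) - Real.sqrt (q y))]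
      _ = 4 := by
        rw [Finset.sum_add_distrib, ← Finset.mul_sum, ← Finset.mul_sum, hps, hqs]; norm_num
  refine abs_le_of_sq_le_sq' ?_ (by positivity) |>.2
  rw [mul_pow, Real.sq_sqrt (h0.trans h1)]
  nlinarith

/-- suboptimality gap from small potential. If `Φ(π_θ) ≤ ε`, then
`v_TV(θ⋆; D_src) − v_TV(θ; D_src) ≤ 2√2 (r_max + 3βB²) sqrt((1 + 4ρ²/ν) ε)`. -/
theorem suboptimality_gap_of_potential_le {X Y : Type*} [Fintype X] [Fintype Y] [Nonempty Y]
    {d : ℕ} (ψ : X → Y → EuclideanSpace ℝ (Fin d)) (hψ : ∀ x y, ‖ψ x y‖ ≤ 1)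
    (B ν ρ β rmax ε : ℝ) (hB : 1 ≤ B) (hν : 0 < ν) (hρ : 0 < ρ) (hβ : 0 < β)
    (Dsrc : X → ℝ) (hDsrcν : ∀ x, ν ≤ Dsrc x) (hDsrcsum : ∑ x : X, Dsrc x = 1)
    (θref : EuclideanSpace ℝ (Fin d)) (hθref : ‖θref‖ ≤ B)
    (r : X → Y → ℝ) (hr : ∀ x y, r x y ∈ Set.Icc 0 rmax)
    (θ θstar : EuclideanSpace ℝ (Fin d)) (hθ : ‖θ‖ ≤ B) (hθstar : ‖θstar‖ ≤ B)
    (hopt : ∀ θ' : EuclideanSpace ℝ (Fin d), ‖θ'‖ ≤ B →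
      robustValue ψ r β θref Dsrc ρ θ' ≤ robustValue ψ r β θref Dsrc ρ θstar)
    (hΦ : potential ψ Dsrc θstar θ ≤ ε) :
    robustValue ψ r β θref Dsrc ρ θstar - robustValue ψ r β θref Dsrc ρ θ ≤
      2 * Real.sqrt 2 * (rmax + 3 * β * B ^ 2) * Real.sqrt ((1 + 4 * ρ ^ 2 / ν) * ε) := by
  classical
  set K : X → ℝ := fun x => ∑ y, softmaxPolicy ψ θstar x y *
    Real.log (softmaxPolicy ψ θstar x y / softmaxPolicy ψ θ x y) with hK
  set M : ℝ := rmax + 2 * β * B with hM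
  have hKp := fun x => weak_pinsker (softmaxPolicy ψ θstar x) (softmaxPolicy ψ θ x)
    (sm_pos ψ θstar x) (sm_pos ψ θ x) (sm_sum ψ θstar x) (sm_sum ψ θ x)
  have hX : Nonempty X := by
    by_contra h
    rw [not_nonempty_iff] at h
    simp at hDsrcsum
  have hrmax : 0 ≤ rmax := by
    obtain ⟨x⟩ := hX
    obtain ⟨y⟩ := ‹Nonempty Y›
    exact (hr x y).1.trans (hr x y).2
  have hM0 : 0 ≤ M := by positivity
  have hD0 : ∀ x, 0 < Dsrc x := fun x => hν.trans_le (hDsrcν x)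
  -- pointwise bound
  have hpt : ∀ x, (∑ y : Y, softmaxPolicy ψ θstar x y *
      (r x y - β * Real.log (softmaxPolicy ψ θstar x y / softmaxPolicy ψ θref x y))) -
      (∑ y : Y, softmaxPolicy ψ θ x y *
      (r x y - β * Real.log (softmaxPolicy ψ θ x y / softmaxPolicy ψ θref x y)))
      ≤ 2 * M * Real.sqrt (K x) := by
    intro x
    obtain ⟨k0, k1⟩ := hKp x
    set c : ℝ := Real.log (∑ y' : Y, Real.exp ⟪θ, ψ x y'⟫) -
      Real.log (∑ y' : Y, Real.exp ⟪θref, ψ x y'⟫) with hc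
    have e1 : ∀ (t : EuclideanSpace ℝ (Fin d)) y,
        Real.log (softmaxPolicy ψ t x y / softmaxPolicy ψ θref x y) =
        Real.log (softmaxPolicy ψ t x y) - Real.log (softmaxPolicy ψ θref x y) := fun t y =>
      Real.log_div (sm_pos ψ t x y).ne' (sm_pos ψ θref x y).ne'
    have e2 : ∀ y,
        Real.log (softmaxPolicy ψ θstar x y / softmaxPolicy ψ θ x y) =
        Real.log (softmaxPolicy ψ θstar x y) - Real.log (softmaxPolicy ψ θ x y) := fun y =>
      Real.log_div (sm_pos ψ θstar x y).ne' (sm_pos ψ θ x y).ne'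
    have key : (∑ y : Y, softmaxPolicy ψ θstar x y *
      (r x y - β * Real.log (softmaxPolicy ψ θstar x y / softmaxPolicy ψ θref x y))) -
      (∑ y : Y, softmaxPolicy ψ θ x y *
      (r x y - β * Real.log (softmaxPolicy ψ θ x y / softmaxPolicy ψ θref x y)))
      = (∑ y : Y, (softmaxPolicy ψ θstar x y - softmaxPolicy ψ θ x y) *
        (r x y - β * ⟪θ - θref, ψ x y⟫)) - β * K x
        + β * c * (∑ y, softmaxPolicy ψ θstar x y - ∑ y, softmaxPolicy ψ θ x y) := by
      simp only [hK]
      rw [mul_sub, Finset.mul_sum, Finset.mul_sum, Finset.mul_sum, ← Finset.sum_sub_distrib,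
        ← Finset.sum_sub_distrib, ← Finset.sum_sub_distrib, ← Finset.sum_add_distrib]
      refine Finset.sum_congr rfl fun y _ => ?_
      rw [e1, e1, e2, sm_log ψ θ, sm_log ψ θref, inner_sub_left]
      simp only [hc]
      ring
    rw [key, sm_sum, sm_sum]
    have b1 : (∑ y : Y, (softmaxPolicy ψ θstar x y - softmaxPolicy ψ θ x y) *
        (r x y - β * ⟪θ - θref, ψ x y⟫)) ≤
        ∑ y, |softmaxPolicy ψ θstar x y - softmaxPolicy ψ θ x y| * M := by
      refine Finset.sum_le_sum fun y _ => ?_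
      refine (le_abs_self _).trans ?_
      rw [abs_mul]
      refine mul_le_mul_of_nonneg_left ?_ (abs_nonneg _)
      have i1 : |⟪θ - θref, ψ x y⟫| ≤ 2 * B := by
        refine (abs_real_inner_le_norm _ _).trans ?_
        have := norm_sub_le θ θref
        have := hψ x y
        nlinarith [norm_nonneg (θ - θref), norm_nonneg (ψ x y)]
      have i2 := abs_le.1 i1
      have := (hr x y).1
      have := (hr x y).2
      rw [abs_le]
      constructor <;> nlinarith
    rw [← Finset.sum_mul] at b1
    have b2 := mul_le_mul_of_nonneg_right k1 hM0
    have b3 : 0 ≤ β * K x := mul_nonneg hβ.le k0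
    have : 2 * Real.sqrt (K x) * M = 2 * M * Real.sqrt (K x) := by ring
    have b2' : (∑ y, |softmaxPolicy ψ θstar x y - softmaxPolicy ψ θ x y|) * M
      ≤ 2 * Real.sqrt (K x) * M := b2
    linarith
  set S : ℝ := Real.sqrt ((1 + 4 * ρ ^ 2 / ν) * ε) with hS
  have hM2 : 2 * M ≤ 2 * Real.sqrt 2 * (rmax + 3 * β * B ^ 2) := by
    have h2 : (1:ℝ) ≤ Real.sqrt 2 := Real.one_le_sqrt.2 (by norm_num)
    have hBB : β * B ≤ β * B ^ 2 := mul_le_mul_of_nonneg_left (by nlinarith) hβ.le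
    have hBp : 0 ≤ β * B ^ 2 := by positivity
    have : M ≤ 1 * (rmax + 3 * β * B ^ 2) := by rw [hM]; nlinarith
    have : 1 * (rmax + 3 * β * B ^ 2) ≤ Real.sqrt 2 * (rmax + 3 * β * B ^ 2) :=
      mul_le_mul_of_nonneg_right h2 (by nlinarith)
    linarith
  have main : ∀ D : X → ℝ, (∀ x, 0 ≤ D x) → (∑ x : X, D x = 1) →
      ((1 / 2) * ∑ x : X, |D x - Dsrc x| ≤ ρ) →
      klValue ψ r β θref θstar D - klValue ψ r β θref θ D ≤ 2 * M * S := by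
    intro D hDn hDs hDt
    unfold klValue
    rw [← Finset.sum_sub_distrib]
    have s1 : ∑ x, D x * Real.sqrt (K x) ≤ S := by
      have cs : (∑ x, D x * Real.sqrt (K x)) ^ 2 ≤
          (∑ x, D x ^ 2 / Dsrc x) * ∑ x, Dsrc x * K x := by
        refine Finset.sum_sq_le_sum_mul_sum_of_sq_eq_mul _
          (fun x _ => div_nonneg (sq_nonneg _) (hD0 x).le)
          (fun x _ => mul_nonneg (hD0 x).le (hKp x).1) fun x _ => ?_
        rw [mul_pow, Real.sq_sqrt (hKp x).1]
        have := (hD0 x).ne'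
        field_simp
        rfl
      have chi : ∑ x, D x ^ 2 / Dsrc x ≤ 1 + 4 * ρ ^ 2 / ν := by
        have c1 : ∑ x, D x ^ 2 / Dsrc x
            = ∑ x, (D x - Dsrc x) ^ 2 / Dsrc x + (2 * ∑ x, D x - ∑ x, Dsrc x) := by
          rw [Finset.mul_sum, ← Finset.sum_sub_distrib, ← Finset.sum_add_distrib]
          refine Finset.sum_congr rfl fun x _ => ?_
          have := (hD0 x).ne'
          field_simp
          ring
        have c2 : ∑ x, (D x - Dsrc x) ^ 2 / Dsrc x ≤ (∑ x, |D x - Dsrc x| ^ 2) / ν := by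
          rw [Finset.sum_div]
          refine Finset.sum_le_sum fun x _ => ?_
          rw [sq_abs]
          exact div_le_div_of_nonneg_left (sq_nonneg _) hν (hDsrcν x)
        have c3 : ∑ x, |D x - Dsrc x| ^ 2 ≤ (∑ x, |D x - Dsrc x|) ^ 2 :=
          Finset.sum_sq_le_sq_sum_of_nonneg fun x _ => abs_nonneg _
        have c4 : (∑ x, |D x - Dsrc x|) ^ 2 ≤ 4 * ρ ^ 2 := by
          have : 0 ≤ ∑ x, |D x - Dsrc x| := Finset.sum_nonneg fun _ _ => abs_nonneg _
          nlinarith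
        have c5 := div_le_div_of_nonneg_right (c3.trans c4) hν.le
        rw [c1, hDs, hDsrcsum]
        linarith
      apply Real.le_sqrt_of_sq_le
      refine cs.trans ?_
      exact mul_le_mul chi hΦ (Finset.sum_nonneg fun x _ => mul_nonneg (hD0 x).le (hKp x).1)
        (by positivity)
    calc _ ≤ ∑ x, 2 * M * (D x * Real.sqrt (K x)) := Finset.sum_le_sum fun x _ => by
            rw [← mul_sub]
            have := mul_le_mul_of_nonneg_left (hpt x) (hDn x)
            linarith
      _ = 2 * M * ∑ x, D x * Real.sqrt (K x) := by rw [Finset.mul_sum]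
      _ ≤ _ := mul_le_mul_of_nonneg_left s1 (by positivity)
  have hfin : 2 * M * S ≤ 2 * Real.sqrt 2 * (rmax + 3 * β * B ^ 2) * S :=
    mul_le_mul_of_nonneg_right hM2 (Real.sqrt_nonneg _)
  refine le_trans ?_ hfin
  rw [sub_le_comm]
  conv_rhs => unfold robustValue
  refine le_csInf ⟨_, Dsrc, fun x => (hD0 x).le, hDsrcsum, by simpa using hρ.le, rfl⟩ ?_
  rintro _ ⟨D, h1, h2, h3, rfl⟩
  have hle : robustValue ψ r β θref Dsrc ρ θstar ≤ klValue ψ r β θref θstar D := by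
    unfold robustValue
    refine csInf_le ⟨-∑ x, |∑ y : Y, softmaxPolicy ψ θstar x y *
      (r x y - β * Real.log (softmaxPolicy ψ θstar x y / softmaxPolicy ψ θref x y))|, ?_⟩
      ⟨D, h1, h2, h3, rfl⟩
    rintro _ ⟨E, g1, g2, g3, rfl⟩
    unfold klValue
    rw [← Finset.sum_neg_distrib]
    refine Finset.sum_le_sum fun x _ => ?_
    have hE : E x ≤ 1 := by
      rw [← g2]
      exact Finset.single_le_sum (fun i _ => g1 i) (Finset.mem_univ x)
    refine le_trans ?_ (neg_abs_le _)
    rw [abs_mul, abs_of_nonneg (g1 x)]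
    exact neg_le_neg (mul_le_of_le_one_left (abs_nonneg _) hE)
  have := main D h1 h2 h3
  linarith
end

section
/- (Lower bound / nonnegativity of the minibatch robust-loss bias.) Let P be a probability distribution, ℓ a loss with |ℓ(x)| ≤ B for all x, and ρ > 0. For i.i.d. samples x₁,…,xₙ ∼ P, E[ sup{ Σ_{i=1}^n q_i ℓ(x_i) : q in the n-simplex, (1/2)Σ_i |q_i − 1/n| ≤ ρ } ] ≤ sup{ E_{x∼Q}[ℓ(x)] : Q a probability distribution with d_TV(Q, P) ≤ ρ }. -/
open MeasureTheory
open scoped BigOperators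

/-- The population TV-robust loss at radius `ρ`:
`sup{ E_Q[ℓ] : Q a probability distribution, d_TV(Q,P) ≤ ρ }`, where
`d_TV(Q,P) = (1/2)∫ |dQ/dP − 1| dP`. -/
noncomputable def robustLossPop {X : Type*} [MeasurableSpace X]
    (P : Measure X) (ℓ : X → ℝ) (ρ : ℝ) : ℝ :=
  sSup { c : ℝ | ∃ Q : Measure X, IsProbabilityMeasure Q ∧ Q ≪ P ∧
    (1 / 2) * (∫ x, |(Q.rnDeriv P x).toReal - 1| ∂P) ≤ ρ ∧ c = ∫ x, ℓ x ∂Q }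

/-- The minibatch TV-robust loss on a sample `x₁,…,xₙ`:
`sup{ Σ_i q_i ℓ(x_i) : q in the n-simplex, (1/2)Σ_i |q_i − 1/n| ≤ ρ }`. -/
noncomputable def robustLossBatch {X : Type*} (ℓ : X → ℝ) (ρ : ℝ)
    {n : ℕ} (xs : Fin n → X) : ℝ :=
  sSup { c : ℝ | ∃ q : Fin n → ℝ, (∀ i, 0 ≤ q i) ∧ (∑ i : Fin n, q i = 1) ∧
    ((1 / 2) * ∑ i : Fin n, |q i - 1 / (n : ℝ)| ≤ ρ) ∧ c = ∑ i : Fin n, q i * ℓ (xs i) }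

lemma batch_bound_aux {n : ℕ} (q y : Fin n → ℝ) (ρ η M : ℝ) (hn : 1 ≤ n)
    (h0 : ∀ i, 0 ≤ q i) (h1 : ∑ i, q i = 1)
    (h2 : (1 / 2) * ∑ i : Fin n, |q i - 1 / (n : ℝ)| ≤ ρ) (hη : η ≤ M) (hy : ∀ i, y i ≤ M) :
    ∑ i, q i * y i ≤ (1 / (n : ℝ)) * ∑ i, max (y i) η + min ρ 1 * (M - η) := by
  have hn0 : (0 : ℝ) < n := by exact_mod_cast hn
  have hsum : ∑ _i : Fin n, (1 / (n : ℝ)) = 1 := by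
    simp; field_simp
  have h3 : (1 / 2) * ∑ i : Fin n, |q i - 1 / (n : ℝ)| ≤ min ρ 1 := by
    refine le_min h2 ?_
    have : ∑ i : Fin n, |q i - 1 / (n : ℝ)| ≤ ∑ i : Fin n, (q i + 1 / (n : ℝ)) := by
      refine Finset.sum_le_sum fun i _ => ?_
      have := h0 i
      have h' : 0 < 1 / (n : ℝ) := by positivity
      rw [abs_le]; constructor <;> linarith
    rw [Finset.sum_add_distrib, h1, hsum] at this
    linarith
  have key : ∀ i, q i * y i ≤ (1 / (n : ℝ)) * max (y i) η
      + ((1 / 2) * |q i - 1 / (n : ℝ)| * (M - η) + (q i - 1 / (n : ℝ)) * ((M + η) / 2)) := by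
    intro i
    have e1 : q i * y i ≤ q i * max (y i) η :=
      mul_le_mul_of_nonneg_left (le_max_left _ _) (h0 i)
    have a1 : η ≤ max (y i) η := le_max_right _ _
    have a2 : max (y i) η ≤ M := max_le (hy i) hη
    set m := max (y i) η
    set d := q i - 1 / (n : ℝ)
    have e2 : d * (m - (M + η) / 2) ≤ |d| * ((M - η) / 2) := by
      refine (le_abs_self _).trans ?_
      rw [abs_mul]
      refine mul_le_mul_of_nonneg_left ?_ (abs_nonneg _)
      rw [abs_le]; constructor <;> linarith
    have : q i = d + 1 / (n : ℝ) := by simp [d]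
    rw [this] at e1
    rw [this]
    nlinarith
  refine (Finset.sum_le_sum fun i _ => key i).trans ?_
  rw [Finset.sum_add_distrib, Finset.sum_add_distrib, ← Finset.mul_sum, ← Finset.sum_mul,
    ← Finset.sum_mul, ← Finset.mul_sum, Finset.sum_sub_distrib, h1, hsum]
  have := mul_le_mul_of_nonneg_right h3 (sub_nonneg.2 hη)
  linarith

lemma uniform_feasible {n : ℕ} (hn : 1 ≤ n) (ρ : ℝ) (hρ : 0 < ρ) (y : Fin n → ℝ) :
    { c : ℝ | ∃ q : Fin n → ℝ, (∀ i, 0 ≤ q i) ∧ (∑ i : Fin n, q i = 1) ∧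
    ((1 / 2) * ∑ i : Fin n, |q i - 1 / (n : ℝ)| ≤ ρ) ∧ c = ∑ i : Fin n, q i * y i }.Nonempty := by
  have hn0 : (0 : ℝ) < n := by exact_mod_cast hn
  refine ⟨_, fun _ => 1 / (n : ℝ), fun i => by positivity, ?_, ?_, rfl⟩
  · simp; field_simp
  · simp [hρ.le]

lemma batch_bdd {n : ℕ} (ρ : ℝ) (y : Fin n → ℝ) :
    BddAbove { c : ℝ | ∃ q : Fin n → ℝ, (∀ i, 0 ≤ q i) ∧ (∑ i : Fin n, q i = 1) ∧
    ((1 / 2) * ∑ i : Fin n, |q i - 1 / (n : ℝ)| ≤ ρ) ∧ c = ∑ i : Fin n, q i * y i } := by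
  refine ⟨‖y‖, ?_⟩
  rintro c ⟨q, h0, h1, -, rfl⟩
  calc ∑ i, q i * y i ≤ ∑ i, q i * ‖y‖ := Finset.sum_le_sum fun i _ =>
        mul_le_mul_of_nonneg_left ((le_abs_self _).trans (norm_le_pi_norm y i)) (h0 i)
    _ = ‖y‖ := by rw [← Finset.sum_mul, h1, one_mul]

lemma batch_lipschitz {n : ℕ} (hn : 1 ≤ n) (ρ : ℝ) (hρ : 0 < ρ) :
    LipschitzWith 1 (fun y : Fin n → ℝ => robustLossBatch (fun x : ℝ => x) ρ y) := by
  refine LipschitzWith.of_le_add fun y z => ?_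
  refine csSup_le (uniform_feasible hn ρ hρ y) ?_
  rintro c ⟨q, h0, h1, h2, rfl⟩
  have hz : ∑ i, q i * z i ≤ robustLossBatch (fun x : ℝ => x) ρ z :=
    le_csSup (batch_bdd ρ z) ⟨q, h0, h1, h2, rfl⟩
  have : ∑ i, q i * y i ≤ ∑ i, (q i * z i + q i * dist y z) := by
    refine Finset.sum_le_sum fun i _ => ?_
    rw [← mul_add]
    refine mul_le_mul_of_nonneg_left ?_ (h0 i)
    have h := dist_le_pi_dist y z i
    rw [Real.dist_eq] at h
    linarith [le_abs_self (y i - z i)]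
  rw [Finset.sum_add_distrib, ← Finset.sum_mul, h1] at this
  linarith

lemma exists_quantile {X : Type*} [MeasurableSpace X]
    (P : Measure X) [IsProbabilityMeasure P]
    (ℓ : X → ℝ) (hmeas : Measurable ℓ) (r M : ℝ) (hr0 : 0 < r) (hr1 : r ≤ 1)
    (hM : ∀ᵐ x ∂P, ℓ x ≤ M) :
    ∃ η ≤ M, P.real {x | ℓ x < η} ≤ r ∧ r ≤ P.real {x | ℓ x ≤ η} := by
  have hP : IsProbabilityMeasure (P.map ℓ) := Measure.isProbabilityMeasure_map hmeas.aemeasurable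
  set F := ProbabilityTheory.cdf (P.map ℓ) with hF
  have hFe : ∀ t, F t = P.real {x | ℓ x ≤ t} := by
    intro t
    rw [hF, ProbabilityTheory.cdf_eq_real, map_measureReal_apply hmeas measurableSet_Iic]
    rfl
  set S := {t | r ≤ F t}
  have hMS : M ∈ S := by
    change r ≤ F M
    rw [hFe]
    have : P.real {x | ℓ x ≤ M} = 1 := by
      rw [measureReal_def, (measure_congr (Filter.eventuallyEq_univ.2 hM) : P {x | ℓ x ≤ M} = P Set.univ)]; simp
    linarith
  have hSb : BddBelow S := by
    have := (ProbabilityTheory.tendsto_cdf_atBot (P.map ℓ)).eventually (gt_mem_nhds hr0)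
    obtain ⟨a, ha⟩ := Filter.eventually_atBot.1 this
    refine ⟨a, fun t ht => ?_⟩
    by_contra hlt
    exact absurd (ha t (not_le.1 hlt).le) (not_lt.2 ht)
  refine ⟨sInf S, csInf_le hSb hMS, ?_, ?_⟩
  · -- left limit
    have hu : {x | ℓ x < sInf S} = ⋃ k : ℕ, {x | ℓ x ≤ sInf S - 1 / ((k : ℝ) + 1)} := by
      ext x
      simp only [Set.mem_setOf_eq, Set.mem_iUnion]
      constructor
      · intro h
        obtain ⟨k, hk⟩ := exists_nat_one_div_lt (sub_pos.2 h)
        exact ⟨k, by linarith⟩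
      · rintro ⟨k, hk⟩
        have : (0 : ℝ) < 1 / ((k : ℝ) + 1) := by positivity
        linarith
    have hmono : Monotone fun k : ℕ => {x | ℓ x ≤ sInf S - 1 / ((k : ℝ) + 1)} := by
      intro a b hab x hx
      simp only [Set.mem_setOf_eq] at hx ⊢
      have := Nat.one_div_le_one_div (α := ℝ) hab
      linarith
    have ht := tendsto_measure_iUnion_atTop (μ := P) hmono
    rw [← hu] at ht
    have ht' := (ENNReal.tendsto_toReal (measure_ne_top P _)).comp ht
    refine le_of_tendsto ht' (Filter.Eventually.of_forall fun k => ?_)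
    change P.real {x | ℓ x ≤ sInf S - 1 / ((k : ℝ) + 1)} ≤ r
    rw [← hFe]
    by_contra hc
    have h1 : sInf S ≤ sInf S - 1 / ((k : ℝ) + 1) := csInf_le hSb (not_le.1 hc).le
    have : (0 : ℝ) < 1 / ((k : ℝ) + 1) := by positivity
    linarith
  · rw [← hFe]
    have hc : ContinuousWithinAt F (Set.Ici (sInf S)) (sInf S) := F.right_continuous _
    have hc' : Filter.Tendsto F (nhdsWithin (sInf S) (Set.Ioi (sInf S))) (nhds (F (sInf S))) :=
      hc.mono_left (nhdsWithin_mono _ Set.Ioi_subset_Ici_self)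
    refine ge_of_tendsto hc' ?_
    filter_upwards [self_mem_nhdsWithin] with t ht
    obtain ⟨s, hs, hst⟩ := exists_lt_of_csInf_lt ⟨M, hMS⟩ ht
    exact le_trans hs (F.mono hst.le)

lemma pop_lower {X : Type*} [MeasurableSpace X]
    (P : Measure X) [IsProbabilityMeasure P]
    (ℓ : X → ℝ) (hmeas : Measurable ℓ)
    (B : ℝ) (hB : ∀ x, |ℓ x| ≤ B) (ρ r η M ε : ℝ) (hr0 : 0 < r) (hr : r ≤ ρ) (hr1 : r ≤ 1)
    (h1 : P.real {x | ℓ x < η} ≤ r) (h2 : r ≤ P.real {x | ℓ x ≤ η})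
    (hA : 0 < P.real {x | M - ε < ℓ x}) :
    ∫ x, max (ℓ x) η ∂P + r * (M - η) - r * ε ≤ robustLossPop P ℓ ρ := by
  have hbdd : BddAbove { c : ℝ | ∃ Q : Measure X, IsProbabilityMeasure Q ∧ Q ≪ P ∧
      (1 / 2) * (∫ x, |(Q.rnDeriv P x).toReal - 1| ∂P) ≤ ρ ∧ c = ∫ x, ℓ x ∂Q } := by
    refine ⟨B, ?_⟩
    rintro c ⟨Q, hQ, -, -, rfl⟩
    have := norm_integral_le_of_norm_le_const (μ := Q) (f := ℓ) (C := B)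
      (Filter.Eventually.of_forall fun x => hB x)
    simp at this
    exact (le_abs_self _).trans this
  have mlt : MeasurableSet {x | ℓ x < η} := measurableSet_lt hmeas measurable_const
  have meq : MeasurableSet {x | ℓ x = η} := measurableSet_eq_fun hmeas measurable_const
  have mA : MeasurableSet {x | M - ε < ℓ x} := measurableSet_lt measurable_const hmeas
  have hsplit : P.real {x | ℓ x ≤ η} = P.real {x | ℓ x < η} + P.real {x | ℓ x = η} := by
    rw [← measureReal_union _ meq]
    · congr 1; ext x; simp [le_iff_lt_or_eq]
    · rw [Set.disjoint_left]; intro x hx hx'; simp at hx hx'; linarith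
  obtain ⟨c, hc0, hc1, hc⟩ : ∃ c : ℝ, 0 ≤ c ∧ c ≤ 1 ∧
      P.real {x | ℓ x < η} + c * P.real {x | ℓ x = η} = r := by
    rcases (measureReal_nonneg (μ := P) (s := {x | ℓ x = η})).eq_or_lt with h | h
    · exact ⟨0, le_rfl, zero_le_one, by linarith⟩
    · refine ⟨(r - P.real {x | ℓ x < η}) / P.real {x | ℓ x = η}, ?_, ?_, ?_⟩
      · exact div_nonneg (by linarith) h.le
      · rw [div_le_one h]; linarith
      · field_simp; ring
  set p := P.real {x | M - ε < ℓ x} with hp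
  let w : X → ℝ := fun x => {x | ℓ x < η}.indicator (fun _ => (1 : ℝ)) x
    + {x | ℓ x = η}.indicator (fun _ => c) x
  let v : X → ℝ := {x | M - ε < ℓ x}.indicator (fun _ => r / p)
  have hwv : ∀ x, (ℓ x < η ∧ w x = 1) ∨ (ℓ x = η ∧ w x = c) ∨ (η < ℓ x ∧ w x = 0) := by
    intro x
    rcases lt_trichotomy (ℓ x) η with h | h | h
    · left; simp [w, h, h.ne]
    · right; left; simp [w, h]
    · right; right; simp [w, h, h.ne', h.le]
  have hw0 : ∀ x, 0 ≤ w x := by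
    intro x; rcases hwv x with ⟨_, h⟩ | ⟨_, h⟩ | ⟨_, h⟩ <;> rw [h] <;> linarith
  have hw1 : ∀ x, w x ≤ 1 := by
    intro x; rcases hwv x with ⟨_, h⟩ | ⟨_, h⟩ | ⟨_, h⟩ <;> rw [h] <;> linarith
  have hv0 : ∀ x, 0 ≤ v x := fun x => Set.indicator_nonneg (fun _ _ => by positivity) x
  have iw1 : Integrable ({x | ℓ x < η}.indicator (fun _ => (1 : ℝ))) P :=
    (integrable_const _).indicator mlt
  have iw2 : Integrable ({x | ℓ x = η}.indicator (fun _ => c)) P :=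
    (integrable_const _).indicator meq
  have iw : Integrable w P := iw1.add iw2
  have iv : Integrable v P := (integrable_const _).indicator mA
  have mw : Measurable w := by
    exact (measurable_const.indicator mlt).add (measurable_const.indicator meq)
  have mv : Measurable v := measurable_const.indicator mA
  have Iw : ∫ x, w x ∂P = r := by
    rw [← hc]
    simp only [w]
    rw [integral_add iw1 iw2, integral_indicator_const _ mlt, integral_indicator_const _ meq]
    simp [mul_comm]
  have Iv : ∫ x, v x ∂P = r := by
    simp only [v]
    rw [integral_indicator_const _ mA, smul_eq_mul, ← hp]
    field_simp
  have il : Integrable ℓ P := Integrable.of_bound hmeas.aestronglyMeasurable B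
    (Filter.Eventually.of_forall hB)
  let h : X → ℝ := fun x => 1 - w x + v x
  have hh0 : ∀ x, 0 ≤ h x := fun x => by
    have := hw1 x; have := hv0 x; simp only [h]; linarith
  have mh : Measurable h := (measurable_const.sub mw).add mv
  have i1w : Integrable (fun x => 1 - w x) P := (integrable_const _).sub iw
  have ih : Integrable h P := i1w.add iv
  have Ih : ∫ x, h x ∂P = 1 := by
    simp only [h]
    rw [integral_add i1w iv, integral_sub (integrable_const _) iw, Iw, Iv]
    simp
  let Q := P.withDensity fun x => ENNReal.ofReal (h x)
  have mhe : Measurable fun x => ENNReal.ofReal (h x) := mh.ennreal_ofReal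
  have hQ : IsProbabilityMeasure Q := by
    constructor
    simp only [Q]
    rw [withDensity_apply _ MeasurableSet.univ, setLIntegral_univ,
      ← ofReal_integral_eq_lintegral_ofReal ih (Filter.Eventually.of_forall hh0), Ih]
    simp
  have hTV : (1 / 2) * (∫ x, |(Q.rnDeriv P x).toReal - 1| ∂P) ≤ ρ := by
    have hrn : Q.rnDeriv P =ᵐ[P] fun x => ENNReal.ofReal (h x) :=
      Measure.rnDeriv_withDensity P mhe
    have : ∫ x, |(Q.rnDeriv P x).toReal - 1| ∂P = ∫ x, |h x - 1| ∂P := by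
      refine integral_congr_ae ?_
      filter_upwards [hrn] with x hx
      rw [hx, ENNReal.toReal_ofReal (hh0 x)]
    rw [this]
    have : ∫ x, |h x - 1| ∂P ≤ ∫ x, (w x + v x) ∂P := by
      refine integral_mono (ih.sub (integrable_const _)).abs (iw.add iv) fun x => ?_
      have := hw0 x; have := hv0 x
      simp only [h]
      rw [abs_le]; constructor <;> linarith
    rw [integral_add iw iv, Iw, Iv] at this
    linarith
  have hmem : ∫ x, ℓ x ∂Q ≤ robustLossPop P ℓ ρ :=
    le_csSup hbdd ⟨Q, hQ, withDensity_absolutelyContinuous _ _, hTV, rfl⟩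
  refine le_trans ?_ hmem
  have hQi : ∫ x, ℓ x ∂Q = ∫ x, h x * ℓ x ∂P := by
    simp only [Q]
    rw [integral_withDensity_eq_integral_toReal_smul mhe (by simp)]
    refine integral_congr_ae (Filter.Eventually.of_forall fun x => ?_)
    simp [ENNReal.toReal_ofReal (hh0 x)]
  rw [hQi]
  have imax : Integrable (fun x => max (ℓ x) η) P := il.sup (integrable_const η)
  have ihl : Integrable (fun x => h x * ℓ x) P :=
    ih.mul_bdd hmeas.aestronglyMeasurable (Filter.Eventually.of_forall hB)
  have i2 : Integrable (fun x => max (ℓ x) η - w x * η) P := imax.sub (iw.mul_const η)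
  have : ∫ x, (max (ℓ x) η - w x * η + v x * (M - ε)) ∂P ≤ ∫ x, h x * ℓ x ∂P := by
    refine integral_mono (i2.add (iv.mul_const _)) ihl fun x => ?_
    have e1 : max (ℓ x) η - w x * η = (1 - w x) * ℓ x := by
      rcases hwv x with ⟨h, h'⟩ | ⟨h, h'⟩ | ⟨h, h'⟩ <;> rw [h']
      · rw [max_eq_right h.le]; ring
      · rw [h, max_self]; ring
      · rw [max_eq_left h.le]; ring
    have e2 : v x * (M - ε) ≤ v x * ℓ x := by
      by_cases hx : M - ε < ℓ x
      · exact mul_le_mul_of_nonneg_left hx.le (hv0 x)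
      · simp [v, hx]
    simp only [h]
    rw [e1, add_mul]
    linarith
  rw [integral_add i2 (iv.mul_const _), integral_sub imax (iw.mul_const η),
    integral_mul_const, integral_mul_const, Iw, Iv] at this
  linarith

/-- nonnegativity of the minibatch robust-loss bias:
`E_{xⁿ∼Pⁿ}[ sup_{q} Σ_i q_i ℓ(x_i) ] ≤ sup{ E_Q[ℓ] : d_TV(Q,P) ≤ ρ }`. -/
theorem expected_minibatch_robust_loss_le {X : Type*} [MeasurableSpace X]
    (P : Measure X) [IsProbabilityMeasure P]
    (ℓ : X → ℝ) (hmeas : Measurable ℓ)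
    (B : ℝ) (hB : ∀ x, |ℓ x| ≤ B)
    (ρ : ℝ) (hρ : 0 < ρ) (n : ℕ) (hn : 1 ≤ n) :
    ∫ xs, robustLossBatch ℓ ρ xs ∂(Measure.pi fun _ : Fin n => P) ≤
      robustLossPop P ℓ ρ := by
  have hn0 : (0 : ℝ) < n := by exact_mod_cast hn
  set M := essSup ℓ P with hMdef
  have hbu : Filter.IsBoundedUnder (· ≤ ·) (ae P) ℓ :=
    Filter.isBoundedUnder_of ⟨B, fun x => (abs_le.1 (hB x)).2⟩
  have hbl : Filter.IsBoundedUnder (· ≥ ·) (ae P) ℓ :=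
    Filter.isBoundedUnder_of ⟨-B, fun x => (abs_le.1 (hB x)).1⟩
  have hM : ∀ᵐ x ∂P, ℓ x ≤ M := ae_le_essSup hbu
  have hA : ∀ ε > 0, 0 < P.real {x | M - ε < ℓ x} := by
    intro ε hε
    refine lt_of_le_of_ne measureReal_nonneg fun h0 => ?_
    have h1 : P {x | M - ε < ℓ x} = 0 := (measureReal_eq_zero_iff).1 h0.symm
    have h2 : ∀ᵐ x ∂P, ℓ x ≤ M - ε := by
      rw [ae_iff]; simpa using h1
    have h3 : M ≤ M - ε := essSup_le_of_ae_le _ h2 hbl.isCoboundedUnder_le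
    linarith
  set r := min ρ 1
  have hr0 : 0 < r := lt_min hρ one_pos
  obtain ⟨η, hηM, hq1, hq2⟩ := exists_quantile P ℓ hmeas r M hr0 (min_le_right _ _) hM
  have hpop : ∫ x, max (ℓ x) η ∂P + r * (M - η) ≤ robustLossPop P ℓ ρ := by
    refine le_of_forall_pos_le_add fun δ hδ => ?_
    have := pop_lower P ℓ hmeas B hB ρ r η M (δ / r) hr0 (min_le_left _ _) (min_le_right _ _)
      hq1 hq2 (hA _ (by positivity))
    rw [mul_div_cancel₀ _ hr0.ne'] at this
    linarith
  refine le_trans ?_ hpop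
  have il : Integrable ℓ P := Integrable.of_bound hmeas.aestronglyMeasurable B
    (Filter.Eventually.of_forall hB)
  have imax : Integrable (fun x => max (ℓ x) η) P := il.sup (integrable_const η)
  have mp : ∀ i : Fin n, MeasurePreserving (Function.eval i) (Measure.pi fun _ : Fin n => P) P :=
    fun i => measurePreserving_eval (fun _ : Fin n => P) i
  have ii : ∀ i : Fin n, Integrable (fun xs : Fin n → X => max (ℓ (xs i)) η)
      (Measure.pi fun _ : Fin n => P) := fun i => (mp i).integrable_comp_of_integrable imax
  have hI : ∀ i : Fin n, ∫ xs : Fin n → X, max (ℓ (xs i)) η ∂(Measure.pi fun _ : Fin n => P)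
      = ∫ x, max (ℓ x) η ∂P := by
    intro i
    have := integral_map (μ := Measure.pi fun _ : Fin n => P) (mp i).measurable.aemeasurable
      (f := fun x => max (ℓ x) η) (by rw [(mp i).map_eq]; exact imax.aestronglyMeasurable)
    rw [(mp i).map_eq] at this
    exact this.symm
  have iU : Integrable (fun xs : Fin n → X => (1 / (n : ℝ)) * ∑ i, max (ℓ (xs i)) η
      + r * (M - η)) (Measure.pi fun _ : Fin n => P) :=
    ((integrable_finsetSum _ fun i _ => ii i).const_mul _).add (integrable_const _)
  have hU : ∫ xs : Fin n → X, ((1 / (n : ℝ)) * ∑ i, max (ℓ (xs i)) η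
      + r * (M - η)) ∂(Measure.pi fun _ : Fin n => P) = ∫ x, max (ℓ x) η ∂P + r * (M - η) := by
    rw [integral_add ((integrable_finsetSum _ fun i _ => ii i).const_mul _) (integrable_const _),
      integral_const_mul, integral_finsetSum _ fun i _ => ii i]
    simp only [hI]
    simp
    field_simp
  rw [← hU]
  have hmb : Measurable fun xs : Fin n → X => robustLossBatch ℓ ρ xs := by
    have : (fun xs : Fin n → X => robustLossBatch ℓ ρ xs) =
      (fun y : Fin n → ℝ => robustLossBatch (fun x : ℝ => x) ρ y) ∘ fun xs i => ℓ (xs i) := rfl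
    rw [this]
    refine (batch_lipschitz hn ρ hρ).continuous.measurable.comp ?_
    exact measurable_pi_lambda _ fun i => hmeas.comp (measurable_pi_apply i)
  have ib : Integrable (fun xs : Fin n → X => robustLossBatch ℓ ρ xs)
      (Measure.pi fun _ : Fin n => P) := by
    refine Integrable.of_bound hmb.aestronglyMeasurable B (Filter.Eventually.of_forall fun xs => ?_)
    have hle : ∀ q : Fin n → ℝ, (∀ i, 0 ≤ q i) → ∑ i, q i = 1 →
        |∑ i, q i * ℓ (xs i)| ≤ B := by
      intro q h0 h1
      calc |∑ i, q i * ℓ (xs i)| ≤ ∑ i, |q i * ℓ (xs i)| := Finset.abs_sum_le_sum_abs _ _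
        _ ≤ ∑ i, q i * B := Finset.sum_le_sum fun i _ => by
            rw [abs_mul, abs_of_nonneg (h0 i)]
            exact mul_le_mul_of_nonneg_left (hB _) (h0 i)
        _ = B := by rw [← Finset.sum_mul, h1, one_mul]
    have hne := uniform_feasible hn ρ hρ fun i => ℓ (xs i)
    rw [Real.norm_eq_abs, abs_le]
    constructor
    · obtain ⟨c, hc⟩ := hne
      refine le_trans ?_ (le_csSup (batch_bdd ρ fun i => ℓ (xs i)) hc)
      obtain ⟨q, h0, h1, -, rfl⟩ := hc
      exact (abs_le.1 (hle q h0 h1)).1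
    · refine csSup_le hne ?_
      rintro c ⟨q, h0, h1, -, rfl⟩
      exact (abs_le.1 (hle q h0 h1)).2
  refine integral_mono_ae ib iU ?_
  have hall : ∀ᵐ xs ∂(Measure.pi fun _ : Fin n => P), ∀ i : Fin n, ℓ (xs i) ≤ M :=
    ae_all_iff.2 fun i => (mp i).quasiMeasurePreserving.ae hM
  filter_upwards [hall] with xs hxs
  refine csSup_le (uniform_feasible hn ρ hρ fun i => ℓ (xs i)) ?_
  rintro c ⟨q, h0, h1, h2, rfl⟩
  exact batch_bound_aux q (fun i => ℓ (xs i)) ρ η M hn h0 h1 h2 hηM hxs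
end
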